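/- The elements g_1,…,g_{n−1} of H_{n,r} satisfy the braid relations: g_i·g_j = g_j·g_i for |i − j| > 1, and g_i·g_{i+1}·g_i = g_{i+1}·g_i·g_{i+1} for 1 ≤ i ≤ n−2. -/

import Mathlib

open Polynomial

namespace MAK

noncomputable section

variable (R : Type*) [CommRing R] (n r : ℕ) (q Δ : Rˣ) (u : Fin r → R) (F : Fin r → R[X])

/-- The free `R`-algebra on generators `t_1, …, t_n` (left) and `T_1, …, T_{n-1}` (right). -/
abbrev FA := FreeAlgebra R (Fin n ⊕ Fin (n - 1))

/-- The generators `t_i`. -/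
def tf (i : Fin n) : FA R n := FreeAlgebra.ι R (Sum.inl i)

/-- The generators `T_j`. -/
def Tf (j : Fin (n - 1)) : FA R n := FreeAlgebra.ι R (Sum.inr j)

/-- The index `j`, viewed in `Fin n`. -/
def lo (j : Fin (n - 1)) : Fin n := ⟨j.1, by have := j.2; omega⟩

/-- The index `j + 1`, viewed in `Fin n`. -/
def hi (j : Fin (n - 1)) : Fin n := ⟨j.1 + 1, by have := j.2; omega⟩

/-- The element `B_j = Δ⁻² Σ_{c1<c2} (u_{c2} - u_{c1})(q - q⁻¹) F_{c1}(t_j) F_{c2}(t_{j+1})`. -/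
def Bel (j : Fin (n - 1)) : FA R n :=
  ∑ c2 : Fin r, ∑ c1 ∈ Finset.univ.filter (fun c1 => c1 < c2),
    (((Δ⁻¹ : Rˣ) : R) ^ 2 * ((u c2 - u c1) * ((q : R) - ((q⁻¹ : Rˣ) : R)))) •
      (aeval (tf R n (lo n j)) (F c1) * aeval (tf R n (hi n j)) (F c2))

/-- The defining relations of the modified Ariki-Koike algebra. -/
inductive Rel : FA R n → FA R n → Prop
  | quad (j : Fin (n - 1)) :
      Rel ((Tf R n j - algebraMap R (FA R n) (q : R)) *
        (Tf R n j + algebraMap R (FA R n) ((q⁻¹ : Rˣ) : R))) 0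
  | tord (i : Fin n) : Rel (aeval (tf R n i) (∏ c : Fin r, (X - C (u c)))) 0
  | braid (j k : Fin (n - 1)) (h : k.1 = j.1 + 1) :
      Rel (Tf R n j * Tf R n k * Tf R n j) (Tf R n k * Tf R n j * Tf R n k)
  | Tcomm (j k : Fin (n - 1)) (h : j.1 + 2 ≤ k.1 ∨ k.1 + 2 ≤ j.1) :
      Rel (Tf R n j * Tf R n k) (Tf R n k * Tf R n j)
  | tcomm (i i' : Fin n) : Rel (tf R n i * tf R n i') (tf R n i' * tf R n i)
  | Tt (j : Fin (n - 1)) (i : Fin n) (h1 : i ≠ lo n j) (h2 : i ≠ hi n j) :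
      Rel (Tf R n j * tf R n i) (tf R n i * Tf R n j)
  | Thi (j : Fin (n - 1)) :
      Rel (Tf R n j * tf R n (hi n j)) (tf R n (lo n j) * Tf R n j + Bel R n r q Δ u F j)
  | Tlo (j : Fin (n - 1)) :
      Rel (Tf R n j * tf R n (lo n j)) (tf R n (hi n j) * Tf R n j - Bel R n r q Δ u F j)

/-- The modified Ariki-Koike algebra `H_{n,r}(R, q, u_1, …, u_r)`. -/
abbrev Hnr := RingQuot (Rel R n r q Δ u F)

/-- The canonical projection. -/
def pim : FA R n →ₐ[R] Hnr R n r q Δ u F := RingQuot.mkAlgHom R (Rel R n r q Δ u F)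

/-- The generator `t_i` of `H_{n,r}`. -/
def tt (i : Fin n) : Hnr R n r q Δ u F := pim R n r q Δ u F (tf R n i)

/-- The generator `T_j` of `H_{n,r}`. -/
def TT (j : Fin (n - 1)) : Hnr R n r q Δ u F := pim R n r q Δ u F (Tf R n j)

/-- The Lagrange basis polynomial `∏_{j ≠ c} (X - u_j)/(u_c - u_j)`. -/
def bpoly (c : Fin r) : R[X] :=
  ∏ j ∈ Finset.univ.filter (fun j => j ≠ c), Ring.inverse (u c - u j) • (X - C (u j))

/-- The idempotent `b_{k_1, …, k_n}`. -/
def b (k : Fin n → Fin r) : Hnr R n r q Δ u F :=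
  (List.ofFn fun i : Fin n => aeval (tt R n r q Δ u F i) (bpoly R r u (k i))).prod

/-- The element `B'_{i,j} = -(q - q⁻¹) Σ_{k_i < k_j} b_{k_1, …, k_n}`. -/
def B' (i j : Fin n) : Hnr R n r q Δ u F :=
  -(((q : R) - ((q⁻¹ : Rˣ) : R)) •
    ∑ k ∈ Finset.univ.filter (fun k : Fin n → Fin r => k i < k j), b R n r q Δ u F k)

/-- The element `g_i := T_i + B'_{i,i+1}`. -/
def g (j : Fin (n - 1)) : Hnr R n r q Δ u F :=
  TT R n r q Δ u F j + B' R n r q Δ u F (lo n j) (hi n j)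

/-- The idempotent `e_{i,j} = Σ_{k_i = k_j} b_{k_1, …, k_n}`. -/
def eij (i j : Fin n) : Hnr R n r q Δ u F :=
  ∑ k ∈ Finset.univ.filter (fun k : Fin n → Fin r => k i = k j), b R n r q Δ u F k

/-- The idempotent `e_i = e_{i,i+1}`. -/
def ee (j : Fin (n - 1)) : Hnr R n r q Δ u F := eij R n r q Δ u F (lo n j) (hi n j)

/-- The simple transposition `s_j = (j, j+1)` in `S_n`. -/
def simple (j : Fin (n - 1)) : Equiv.Perm (Fin n) := Equiv.swap (lo n j) (hi n j)

/-- `l` is a reduced word for the permutation `w`. -/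
def IsReducedWord (w : Equiv.Perm (Fin n)) (l : List (Fin (n - 1))) : Prop :=
  (l.map (simple n)).prod = w ∧
    ∀ l' : List (Fin (n - 1)), (l'.map (simple n)).prod = w → l.length ≤ l'.length

/-- The element `g_w = g_{i_1} ⋯ g_{i_l}` associated to a word `l = (i_1, …, i_l)`. -/
def gword (l : List (Fin (n - 1))) : Hnr R n r q Δ u F := (l.map (g R n r q Δ u F)).prod

/-- The element `T_w = T_{i_1} ⋯ T_{i_l}` associated to a word `l = (i_1, …, i_l)`. -/
def Tword (l : List (Fin (n - 1))) : Hnr R n r q Δ u F := (l.map (TT R n r q Δ u F)).prod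

/-- The monomial `t_1^{c_1} ⋯ t_n^{c_n}`. -/
def tmon (c : Fin n → ℕ) : Hnr R n r q Δ u F :=
  (List.ofFn fun i : Fin n => tt R n r q Δ u F i ^ c i).prod

end

end MAK

open MAK


namespace MAK

section Ring

variable {A : Type*} [Ring A]

/-- If `x + d` and `y + e` commute, `x` commutes with `e`, `y` with `d` and `d` with `e`,
then `x` and `y` commute. -/
theorem commute_of_add_commute {x y d e : A} (h : (x + d) * (y + e) = (y + e) * (x + d))
    (hxe : x * e = e * x) (hyd : y * d = d * y) (hde : d * e = e * d) : x * y = y * x := by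
  simp only [add_mul, mul_add, hxe, hyd, hde] at h
  have : x * y + (e * x + d * y + e * d) = y * x + (e * x + d * y + e * d) := by
    rw [← sub_eq_zero] at h ⊢
    rw [← h]
    abel
  exact add_right_cancel this

/-- If `x + a` and `y + b` satisfy the braid relation and quadratic relations with parameter `h`,
then `x` and `y` satisfy the braid relation, provided the corrections are permuted by `x` and `y` as indicated.  Here
`a`, `b`, `c`, `a'`, `b'` play the roles of corrections at the positions `(1, 2)`, `(2, 3)`,
`(1, 3)`, `(2, 1)`, `(3, 2)`. -/
theorem braid_of_add_braid {x y a b c a' b' h : A}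
    (hT : (x + a) * (y + b) * (x + a) = (y + b) * (x + a) * (y + b))
    (hx2 : (x + a) * (x + a) = h * (x + a) + 1) (hy2 : (y + b) * (y + b) = h * (y + b) + 1)
    (hxa : x * a = a' * x) (hxb : x * b = c * x) (hxc : x * c = b * x)
    (hyb : y * b = b' * y) (hya : y * a = c * y) (hyc : y * c = a * y)
    (haa : a * a = h * a) (hbb : b * b = h * b) (hch : c * h = h * c)
    (hab : a * b = b * a) (hac : a * c = c * a) (hbc : b * c = c * b)
    (haab : a * b * a = b * a * b) (hL : h * c + a * b = c * a + c * b) :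
    x * y * x = y * x * y := by
  have hxx : x * x = h * x + 1 - a * x - a' * x := by
    have : x * x = (x + a) * (x + a) - x * a - a * x - a * a := by noncomm_ring
    rw [this, hx2, haa, hxa]
    noncomm_ring
  have hyy : y * y = h * y + 1 - b * y - b' * y := by
    have : y * y = (y + b) * (y + b) - y * b - b * y - b * b := by noncomm_ring
    rw [this, hy2, hbb, hyb]
    noncomm_ring
  have hl : (x + a) * (y + b) * (x + a) = x * y * x + b * x * y + c * (x * x) + c * a' * x
      + a * y * x + a * c * y + a * b * x + a * b * a := by
    have e1 : x * y * a = b * x * y := by rw [mul_assoc, hya, ← mul_assoc, hxc]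
    have e2 : x * b * x = c * (x * x) := by rw [hxb, mul_assoc]
    have e3 : x * b * a = c * a' * x := by rw [hxb, mul_assoc, hxa, mul_assoc]
    have e4 : a * y * a = a * c * y := by rw [mul_assoc, hya, mul_assoc]
    rw [← e1, ← e2, ← e3, ← e4]
    noncomm_ring
  have hr : (y + b) * (x + a) * (y + b) = y * x * y + a * y * x + c * (y * y) + c * b' * y
      + b * x * y + b * c * x + b * a * y + b * a * b := by
    have e1 : y * x * b = a * y * x := by rw [mul_assoc, hxb, ← mul_assoc, hyc]
    have e2 : y * a * y = c * (y * y) := by rw [hya, mul_assoc]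
    have e3 : y * a * b = c * b' * y := by rw [hya, mul_assoc, hyb, mul_assoc]
    have e4 : b * x * b = b * c * x := by rw [mul_assoc, hxb, mul_assoc]
    rw [← e1, ← e2, ← e3, ← e4]
    noncomm_ring
  have hL' : a * b = c * a + c * b - h * c := by rw [← hL]; abel
  rw [hl, hr, hxx, hyy, haab, ← hab, hac, hbc, hL'] at hT
  have hch' (z : A) : c * (h * z) = h * (c * z) := by rw [← mul_assoc, hch, mul_assoc]
  rw [← sub_eq_zero] at hT ⊢
  rw [← hT]
  simp only [mul_add, mul_sub, add_mul, sub_mul, mul_assoc, hch', mul_one]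
  abel

end Ring

section Lagrange

variable {R : Type*} [CommRing R] {r : ℕ} {u : Fin r → R}

theorem isUnit_sub_of_vandermonde {Δ : Rˣ}
    (hΔ : (Δ : R) = ∏ i : Fin r, ∏ j ∈ Finset.univ.filter (fun j => j < i), (u i - u j))
    {c d : Fin r} (hcd : c ≠ d) : IsUnit (u c - u d) := by
  have key (i j : Fin r) (hji : j < i) : IsUnit (u i - u j) := by
    refine isUnit_of_dvd_unit ?_ Δ.isUnit
    rw [hΔ]
    exact (Finset.dvd_prod_of_mem (fun j => u i - u j) (by simpa using hji)).trans
      (Finset.dvd_prod_of_mem (fun i => ∏ j ∈ Finset.univ.filter (fun j => j < i), (u i - u j))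
        (Finset.mem_univ i))
  rcases lt_or_gt_of_ne hcd with h | h
  · rw [← neg_sub]
    exact (key d c h).neg
  · exact key c d h

theorem eval_bpoly (hu : ∀ c d : Fin r, c ≠ d → IsUnit (u c - u d)) (c d : Fin r) :
    (bpoly R r u c).eval (u d) = if d = c then 1 else 0 := by
  rw [bpoly, eval_prod]
  split_ifs with h
  · subst h
    refine Finset.prod_eq_one fun j hj => ?_
    rw [Finset.mem_filter] at hj
    simp [Ring.inverse_mul_cancel _ (hu d j hj.2.symm)]
  · exact Finset.prod_eq_zero (i := d) (by simpa using h) (by simp)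

theorem X_sub_C_mul_bpoly (c : Fin r) :
    ∃ a : R, (X - C (u c)) * bpoly R r u c = C a * ∏ d : Fin r, (X - C (u d)) := by
  refine ⟨∏ j ∈ Finset.univ.filter (fun j => j ≠ c), Ring.inverse (u c - u j), ?_⟩
  rw [bpoly, Finset.prod_smul, smul_eq_C_mul, Finset.filter_ne',
    ← Finset.mul_prod_erase Finset.univ _ (Finset.mem_univ c)]
  ring

theorem sum_bpoly [IsDomain R] (hr : 1 ≤ r) (hu : ∀ c d : Fin r, c ≠ d → IsUnit (u c - u d)) :
    ∑ c, bpoly R r u c = 1 := by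
  have hinj : Function.Injective u := fun c d h => by
    by_contra hcd
    simpa [h] using hu c d hcd
  refine eq_of_degrees_lt_of_eval_index_eq Finset.univ hinj.injOn ?_ ?_ fun d _ => ?_
  · refine (degree_sum_le _ _).trans_lt ((Finset.sup_lt_iff (WithBot.bot_lt_coe _)).2 fun c _ => ?_)
    rw [bpoly, Finset.prod_smul, Finset.filter_ne']
    refine (degree_smul_le _ _).trans_lt ?_
    rw [degree_prod]
    simp only [degree_X_sub_C, Finset.sum_const, Finset.card_erase_of_mem (Finset.mem_univ c),
      Finset.card_univ, Fintype.card_fin, nsmul_eq_mul, mul_one]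
    exact_mod_cast (by omega : r - 1 < r)
  · rw [degree_one, Finset.card_univ, Fintype.card_fin]
    exact_mod_cast (by omega : 0 < r)
  · simp [eval_finsetSum, eval_bpoly hu]

theorem aeval_mul_eq_eval_smul {S : Type*} [CommRing S] [Algebra R S] {x y : S} {a : R}
    (h : x * y = a • y) (p : R[X]) : aeval x p * y = p.eval a • y := by
  induction p using Polynomial.induction_on' with
  | add p q hp hq => simp [add_mul, hp, hq, add_smul]
  | monomial m c =>
    have hm : x ^ m * y = a ^ m • y := by
      induction m with
      | zero => simp
      | succ m ih => rw [pow_succ, mul_assoc, h, mul_smul_comm, ih, smul_smul, pow_succ']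
    rw [aeval_monomial, mul_assoc, hm, eval_monomial, ← Algebra.smul_def, smul_smul]

end Lagrange

section FunctionHom

variable {R : Type*} [CommRing R] {n r : ℕ} {u : Fin r → R}

/-- Commuting elements annihilated by `∏ (X - u_c)`, with all `u_c - u_d` invertible, are
simultaneously diagonalizable: they are the images of the coordinate functions under a homomorphism
from the algebra of functions on index tuples. -/
theorem exists_functionHom_of_comm {S : Type*} [CommRing S] [Algebra R S] [IsDomain R]
    (hr : 1 ≤ r) (hu : ∀ c d : Fin r, c ≠ d → IsUnit (u c - u d)) (t : Fin n → S)
    (ht : ∀ i, aeval (t i) (∏ c : Fin r, (X - C (u c))) = 0) :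
    ∃ Φ : ((Fin n → Fin r) → R) →ₐ[R] S, ∀ i, Φ (fun k => u (k i)) = t i := by
  let β (k : Fin n → Fin r) : S := ∏ i, aeval (t i) (bpoly R r u (k i))
  have hsum : ∑ k, β k = 1 := by
    have h := Finset.prod_univ_sum (fun _ : Fin n => (Finset.univ : Finset (Fin r)))
      (fun i c => aeval (t i) (bpoly R r u c))
    rw [Fintype.piFinset_univ] at h
    rw [← h]
    exact Finset.prod_eq_one fun i _ => by rw [← map_sum, sum_bpoly hr hu, map_one]
  have htβ (i : Fin n) (k : Fin n → Fin r) : t i * β k = u (k i) • β k := by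
    have h : (t i - algebraMap R S (u (k i))) * aeval (t i) (bpoly R r u (k i)) = 0 := by
      obtain ⟨a, ha⟩ := X_sub_C_mul_bpoly (u := u) (k i)
      have := congrArg (aeval (t i)) ha
      simpa only [map_mul, map_sub, aeval_X, aeval_C, ht, mul_zero] using this
    simp only [β]
    rw [← sub_eq_zero, Algebra.smul_def, ← sub_mul,
      ← Finset.mul_prod_erase Finset.univ _ (Finset.mem_univ i), ← mul_assoc, h, zero_mul]
  have hββ (k m : Fin n → Fin r) : β k * β m = if k = m then β m else 0 := by
    have h : β k * β m = (∏ i, (bpoly R r u (k i)).eval (u (m i))) • β m := by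
      have key (s : Finset (Fin n)) : (∏ i ∈ s, aeval (t i) (bpoly R r u (k i))) * β m
          = (∏ i ∈ s, (bpoly R r u (k i)).eval (u (m i))) • β m := by
        induction s using Finset.induction_on with
        | empty => simp
        | insert i s his ih =>
          rw [Finset.prod_insert his, Finset.prod_insert his, mul_assoc, ih, mul_smul_comm,
            aeval_mul_eq_eval_smul (htβ i m), smul_smul, mul_comm]
      exact key Finset.univ
    rw [h]
    split_ifs with hkm
    · simp [hkm, eval_bpoly hu]
    · obtain ⟨i, hi⟩ := Function.ne_iff.1 hkm
      rw [Finset.prod_eq_zero (Finset.mem_univ i), zero_smul]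
      rw [eval_bpoly hu, if_neg hi.symm]
  refine ⟨AlgHom.ofLinearMap (∑ k, (LinearMap.proj k).smulRight (β k)) ?_ ?_, fun i => ?_⟩
  · simpa using hsum
  · intro f g
    simp only [LinearMap.sum_apply, LinearMap.smulRight_apply, LinearMap.proj_apply,
      Pi.mul_apply, Finset.sum_mul_sum, smul_mul_smul_comm, hββ]
    simp
  · simp only [AlgHom.ofLinearMap_apply, LinearMap.sum_apply, LinearMap.smulRight_apply,
      LinearMap.proj_apply, ← htβ]
    rw [← Finset.mul_sum, hsum, mul_one]

open scoped IsMulCommutative in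
theorem exists_functionHom {A : Type*} [Ring A] [Algebra R A] [IsDomain R]
    (hr : 1 ≤ r) (hu : ∀ c d : Fin r, c ≠ d → IsUnit (u c - u d)) (t : Fin n → A)
    (hcomm : ∀ i j, t i * t j = t j * t i)
    (ht : ∀ i, aeval (t i) (∏ c : Fin r, (X - C (u c))) = 0) :
    ∃ Φ : ((Fin n → Fin r) → R) →ₐ[R] A, ∀ i, Φ (fun k => u (k i)) = t i := by
  let S := Algebra.adjoin R (Set.range t)
  have : IsMulCommutative S := Algebra.isMulCommutative_adjoin R (by
    rintro _ ⟨i, rfl⟩ _ ⟨j, rfl⟩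
    exact hcomm i j)
  let τ (i : Fin n) : S := ⟨t i, Algebra.subset_adjoin ⟨i, rfl⟩⟩
  obtain ⟨Φ, hΦ⟩ := exists_functionHom_of_comm (S := S) hr hu τ fun i => by
    apply Subtype.ext
    have := aeval_algHom_apply S.val (τ i) (∏ c : Fin r, (X - C (u c)))
    exact this.symm.trans (ht i)
  exact ⟨S.val.comp Φ, fun i => congrArg Subtype.val (hΦ i)⟩

theorem aeval_functionHom {A : Type*} [Ring A] [Algebra R A] {K : Type*}
    (Φ : (K → R) →ₐ[R] A) (f : K → R) (p : R[X]) :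
    aeval (Φ f) p = Φ (fun k => p.eval (f k)) := by
  rw [aeval_algHom_apply]
  congr 1
  funext k
  rw [← coe_aeval_eq_eval]
  exact (aeval_algHom_apply (Pi.evalAlgHom R (fun _ : K => R) k) f p).symm

theorem prod_eval_bpoly (hu : ∀ c d : Fin r, c ≠ d → IsUnit (u c - u d)) (k : Fin n → Fin r) :
    (fun m : Fin n → Fin r => ∏ i, (bpoly R r u (k i)).eval (u (m i))) = Pi.single k 1 := by
  funext m
  rw [Pi.single_apply]
  split_ifs with h
  · simp [h, eval_bpoly hu]
  · obtain ⟨i, hi⟩ := Function.ne_iff.1 h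
    exact Finset.prod_eq_zero (Finset.mem_univ i) (by rw [eval_bpoly hu, if_neg hi])

/-- An element that intertwines the coordinate functions up to a permutation of the positions
intertwines all functions. -/
theorem intertwine_functionHom {A : Type*} [Ring A] [Algebra R A]
    (hu : ∀ c d : Fin r, c ≠ d → IsUnit (u c - u d)) (Φ : ((Fin n → Fin r) → R) →ₐ[R] A)
    (σ : Equiv.Perm (Fin n)) (x : A)
    (hx : ∀ i, x * Φ (fun k => u (k i)) = Φ (fun k => u (k (σ i))) * x)
    (f : (Fin n → Fin r) → R) : x * Φ f = Φ (fun k => f (k ∘ σ)) * x := by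
  let S : Subalgebra R ((Fin n → Fin r) → R) :=
    { carrier := {f | x * Φ f = Φ (fun k => f (k ∘ σ)) * x}
      mul_mem' := fun {f g} hf hg => by
        change x * Φ (f * g) = Φ ((fun k => f (k ∘ σ)) * fun k => g (k ∘ σ)) * x
        rw [map_mul, map_mul, ← mul_assoc, hf, mul_assoc, hg, mul_assoc]
      add_mem' := fun {f g} hf hg => by
        change x * Φ (f + g) = Φ ((fun k => f (k ∘ σ)) + fun k => g (k ∘ σ)) * x
        rw [map_add, map_add, mul_add, add_mul, hf, hg]
      algebraMap_mem' := fun a => by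
        change x * Φ (algebraMap R _ a) = Φ (algebraMap R _ a) * x
        rw [AlgHom.commutes, Algebra.commutes] }
  have hcoord (i : Fin n) : (fun k : Fin n → Fin r => u (k i)) ∈ S := hx i
  have hpoly (i : Fin n) (p : R[X]) : (fun k : Fin n → Fin r => p.eval (u (k i))) ∈ S := by
    have h := aeval_functionHom (AlgHom.id R ((Fin n → Fin r) → R)) (fun k => u (k i)) p
    simp only [AlgHom.id_apply] at h
    rw [← h, aeval_eq_sum_range]
    exact sum_mem fun m _ => S.smul_mem (pow_mem (hcoord i) m) _
  have hsingle (k : Fin n → Fin r) : Pi.single k (1 : R) ∈ S := by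
    rw [← prod_eval_bpoly hu k]
    have := prod_mem (S := S) (t := Finset.univ) fun i _ => hpoly i (bpoly R r u (k i))
    convert this using 1
    funext m
    simp
  suffices f ∈ S from this
  rw [pi_eq_sum_univ' f]
  exact sum_mem fun k _ => S.smul_mem (hsingle k) _

end FunctionHom

section ArikiKoike

variable {R : Type*} [CommRing R] {n r : ℕ} {q Δ : Rˣ} {u : Fin r → R} {F : Fin r → R[X]}

theorem pim_rel {x y : FA R n} (h : Rel R n r q Δ u F x y) :
    pim R n r q Δ u F x = pim R n r q Δ u F y :=
  RingQuot.mkAlgHom_rel R h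

theorem pim_aeval_tf (i : Fin n) (p : R[X]) :
    pim R n r q Δ u F (aeval (tf R n i) p) = aeval (tt R n r q Δ u F i) p :=
  (aeval_algHom_apply (pim R n r q Δ u F) (tf R n i) p).symm

theorem tt_comm (i j : Fin n) :
    tt R n r q Δ u F i * tt R n r q Δ u F j = tt R n r q Δ u F j * tt R n r q Δ u F i := by
  simpa only [tt, TT, map_mul] using pim_rel (q := q) (Δ := Δ) (u := u) (F := F) (Rel.tcomm i j)

theorem aeval_tt_eq_zero (i : Fin n) :
    aeval (tt R n r q Δ u F i) (∏ c : Fin r, (X - C (u c))) = 0 := by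
  rw [← pim_aeval_tf, pim_rel (Rel.tord i), map_zero]

theorem TT_mul_self (j : Fin (n - 1)) :
    TT R n r q Δ u F j * TT R n r q Δ u F j
      = algebraMap R _ ((q : R) - ((q⁻¹ : Rˣ) : R)) * TT R n r q Δ u F j + 1 := by
  have h := pim_rel (Rel.quad (r := r) (q := q) (Δ := Δ) (u := u) (F := F) j)
  simp only [map_mul, map_sub, map_add, map_zero, AlgHom.commutes] at h
  change (TT R n r q Δ u F j - _) * (TT R n r q Δ u F j + _) = 0 at h
  rw [sub_mul, mul_add, mul_add, ← map_mul, Units.mul_inv, map_one, ← Algebra.commutes] at h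
  rw [map_sub, sub_mul, ← sub_eq_zero, ← h]
  abel

theorem TT_braid (j k : Fin (n - 1)) (h : k.1 = j.1 + 1) :
    TT R n r q Δ u F j * TT R n r q Δ u F k * TT R n r q Δ u F j
      = TT R n r q Δ u F k * TT R n r q Δ u F j * TT R n r q Δ u F k := by
  simpa only [tt, TT, map_mul] using pim_rel (q := q) (Δ := Δ) (u := u) (F := F) (Rel.braid j k h)

theorem TT_comm (j k : Fin (n - 1)) (h : j.1 + 2 ≤ k.1 ∨ k.1 + 2 ≤ j.1) :
    TT R n r q Δ u F j * TT R n r q Δ u F k = TT R n r q Δ u F k * TT R n r q Δ u F j := by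
  simpa only [tt, TT, map_mul] using pim_rel (q := q) (Δ := Δ) (u := u) (F := F) (Rel.Tcomm j k h)

theorem TT_mul_tt (j : Fin (n - 1)) (i : Fin n) (h₁ : i ≠ lo n j) (h₂ : i ≠ hi n j) :
    TT R n r q Δ u F j * tt R n r q Δ u F i = tt R n r q Δ u F i * TT R n r q Δ u F j := by
  simpa only [tt, TT, map_mul] using pim_rel (q := q) (Δ := Δ) (u := u) (F := F) (Rel.Tt j i h₁ h₂)

theorem TT_mul_tt_hi (j : Fin (n - 1)) :
    TT R n r q Δ u F j * tt R n r q Δ u F (hi n j)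
      = tt R n r q Δ u F (lo n j) * TT R n r q Δ u F j
        + pim R n r q Δ u F (Bel R n r q Δ u F j) := by
  simpa only [tt, TT, map_mul, map_add] using pim_rel (Rel.Thi (q := q) (Δ := Δ) (u := u) (F := F) j)

theorem TT_mul_tt_lo (j : Fin (n - 1)) :
    TT R n r q Δ u F j * tt R n r q Δ u F (lo n j)
      = tt R n r q Δ u F (hi n j) * TT R n r q Δ u F j
        - pim R n r q Δ u F (Bel R n r q Δ u F j) := by
  simpa only [tt, TT, map_mul, map_sub] using pim_rel (Rel.Tlo (q := q) (Δ := Δ) (u := u) (F := F) j)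

/-- The function `k ↦ (q - q⁻¹) [k_i < k_j]`, which corresponds to `-B'_{i,j}`. -/
def correction (r : ℕ) (q : Rˣ) (i j : Fin n) (k : Fin n → Fin r) : R :=
  if k i < k j then (q : R) - ((q⁻¹ : Rˣ) : R) else 0

variable {Φ : ((Fin n → Fin r) → R) →ₐ[R] Hnr R n r q Δ u F}

theorem b_eq_functionHom (hu : ∀ c d : Fin r, c ≠ d → IsUnit (u c - u d))
    (hΦ : ∀ i, Φ (fun k => u (k i)) = tt R n r q Δ u F i) (k : Fin n → Fin r) :
    b R n r q Δ u F k = Φ (Pi.single k 1) := by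
  rw [b, ← prod_eval_bpoly hu k]
  simp only [← hΦ, aeval_functionHom]
  have h := map_list_prod Φ
    (List.ofFn fun (i : Fin n) (m : Fin n → Fin r) => (bpoly R r u (k i)).eval (u (m i)))
  rw [List.map_ofFn, List.prod_ofFn] at h
  refine h.symm.trans (congrArg Φ ?_)
  funext m
  simp

theorem B'_eq_functionHom (hu : ∀ c d : Fin r, c ≠ d → IsUnit (u c - u d))
    (hΦ : ∀ i, Φ (fun k => u (k i)) = tt R n r q Δ u F i) (i j : Fin n) :
    B' R n r q Δ u F i j = -Φ (correction r q i j) := by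
  simp only [B', b_eq_functionHom hu hΦ, ← map_sum, ← map_smul]
  congr 2
  funext k
  simp [correction, Finset.sum_apply, Pi.single_apply]

theorem pim_Bel_eq_functionHom
    (hFeval : ∀ c c' : Fin r, (F c).eval (u c') = if c' = c then (Δ : R) else 0)
    (hΦ : ∀ i, Φ (fun k => u (k i)) = tt R n r q Δ u F i) (j : Fin (n - 1)) :
    pim R n r q Δ u F (Bel R n r q Δ u F j)
      = Φ (fun k => (u (k (hi n j)) - u (k (lo n j))) * correction r q (lo n j) (hi n j) k) := by
  simp only [Bel, map_sum, map_smul, map_mul, pim_aeval_tf, ← hΦ, aeval_functionHom, hFeval]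
  simp only [← map_mul, ← map_smul, ← map_sum]
  congr 1
  funext k
  have hΔ : ((Δ⁻¹ : Rˣ) : R) * Δ = 1 := Δ.inv_mul
  simp only [Finset.sum_apply, Pi.smul_apply, Pi.mul_apply, smul_eq_mul]
  rw [Finset.sum_eq_single (k (hi n j)) (fun c _ hc => by simp [hc.symm]) (by simp)]
  simp only [Finset.sum_filter, if_true]
  rw [Finset.sum_eq_single (k (lo n j)) (fun c _ hc => by simp [hc.symm]) (by simp)]
  simp only [if_true, correction]
  split_ifs
  · linear_combination (u (k (hi n j)) - u (k (lo n j))) * ((q : R) - ((q⁻¹ : Rˣ) : R)) *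
      (((Δ⁻¹ : Rˣ) : R) * Δ + 1) * hΔ
  · rw [mul_zero]

theorem g_mul_functionHom (hu : ∀ c d : Fin r, c ≠ d → IsUnit (u c - u d))
    (hFeval : ∀ c c' : Fin r, (F c).eval (u c') = if c' = c then (Δ : R) else 0)
    (hΦ : ∀ i, Φ (fun k => u (k i)) = tt R n r q Δ u F i) (j : Fin (n - 1))
    (f : (Fin n → Fin r) → R) :
    g R n r q Δ u F j * Φ f = Φ (fun k => f (k ∘ simple n j)) * g R n r q Δ u F j := by
  refine intertwine_functionHom hu Φ (simple n j) _ (fun i => ?_) f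
  simp only [g, B'_eq_functionHom hu hΦ, simple, add_mul, mul_add]
  by_cases h₁ : i = lo n j
  · subst h₁
    rw [Equiv.swap_apply_left, hΦ, hΦ, TT_mul_tt_lo, pim_Bel_eq_functionHom hFeval hΦ, ← hΦ, ← hΦ,
      ← map_neg, ← map_mul, ← map_mul, sub_add, ← map_sub, sub_eq_add_neg, ← map_neg]
    congr 2
    funext k
    simp only [Pi.neg_apply, Pi.sub_apply, Pi.mul_apply]
    ring
  by_cases h₂ : i = hi n j
  · subst h₂
    rw [Equiv.swap_apply_right, hΦ, hΦ, TT_mul_tt_hi, pim_Bel_eq_functionHom hFeval hΦ, ← hΦ,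
      ← hΦ, ← map_neg, ← map_mul, ← map_mul, add_assoc, ← map_add]
    congr 2
    funext k
    simp only [Pi.neg_apply, Pi.add_apply, Pi.mul_apply]
    ring
  · rw [Equiv.swap_apply_of_ne_of_ne h₁ h₂, hΦ, TT_mul_tt j i h₁ h₂, ← hΦ, ← map_neg, ← map_mul,
      ← map_mul, mul_comm]

theorem g_mul_correction (hu : ∀ c d : Fin r, c ≠ d → IsUnit (u c - u d))
    (hFeval : ∀ c c' : Fin r, (F c).eval (u c') = if c' = c then (Δ : R) else 0)
    (hΦ : ∀ i, Φ (fun k => u (k i)) = tt R n r q Δ u F i) (j : Fin (n - 1)) {i i' l l' : Fin n}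
    (hi : simple n j i = i') (hl : simple n j l = l') :
    g R n r q Δ u F j * Φ (correction r q i l)
      = Φ (correction r q i' l') * g R n r q Δ u F j := by
  subst hi hl
  exact g_mul_functionHom hu hFeval hΦ j _

theorem g_add_correction (hu : ∀ c d : Fin r, c ≠ d → IsUnit (u c - u d))
    (hΦ : ∀ i, Φ (fun k => u (k i)) = tt R n r q Δ u F i) (j : Fin (n - 1)) :
    g R n r q Δ u F j + Φ (correction r q (lo n j) (hi n j)) = TT R n r q Δ u F j := by
  rw [g, B'_eq_functionHom hu hΦ, neg_add_cancel_right]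

theorem g_comm (hu : ∀ c d : Fin r, c ≠ d → IsUnit (u c - u d))
    (hFeval : ∀ c c' : Fin r, (F c).eval (u c') = if c' = c then (Δ : R) else 0)
    (hΦ : ∀ i, Φ (fun k => u (k i)) = tt R n r q Δ u F i) (i j : Fin (n - 1))
    (hij : i.1 + 1 < j.1 ∨ j.1 + 1 < i.1) :
    g R n r q Δ u F i * g R n r q Δ u F j = g R n r q Δ u F j * g R n r q Δ u F i := by
  have hfix {i j : Fin (n - 1)} (hij : i.1 + 1 < j.1 ∨ j.1 + 1 < i.1) :
      simple n i (lo n j) = lo n j ∧ simple n i (hi n j) = hi n j := by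
    constructor <;> apply Equiv.swap_apply_of_ne_of_ne <;> rw [Ne, Fin.ext_iff] <;>
      simp only [lo, hi] <;> omega
  refine commute_of_add_commute (d := Φ (correction r q (lo n i) (hi n i)))
    (e := Φ (correction r q (lo n j) (hi n j))) ?_ ?_ ?_ ?_
  · rw [g_add_correction hu hΦ, g_add_correction hu hΦ]
    exact TT_comm i j (by omega)
  · exact g_mul_correction hu hFeval hΦ i (hfix hij).1 (hfix hij).2
  · exact g_mul_correction hu hFeval hΦ j (hfix hij.symm).1 (hfix hij.symm).2
  · rw [← map_mul, ← map_mul, mul_comm]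

theorem g_braid (hu : ∀ c d : Fin r, c ≠ d → IsUnit (u c - u d))
    (hFeval : ∀ c c' : Fin r, (F c).eval (u c') = if c' = c then (Δ : R) else 0)
    (hΦ : ∀ i, Φ (fun k => u (k i)) = tt R n r q Δ u F i) (i j : Fin (n - 1))
    (hij : j.1 = i.1 + 1) :
    g R n r q Δ u F i * g R n r q Δ u F j * g R n r q Δ u F i
      = g R n r q Δ u F j * g R n r q Δ u F i * g R n r q Δ u F j := by
  have hlo : lo n j = hi n i := Fin.ext hij
  have h₁ : simple n i (lo n i) = hi n i := Equiv.swap_apply_left _ _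
  have h₂ : simple n i (hi n i) = lo n i := Equiv.swap_apply_right _ _
  have h₃ : simple n i (hi n j) = hi n j := by
    apply Equiv.swap_apply_of_ne_of_ne <;> rw [Ne, Fin.ext_iff] <;> simp only [lo, hi] <;> omega
  have h₄ : simple n j (hi n i) = hi n j := hlo ▸ Equiv.swap_apply_left _ _
  have h₅ : simple n j (hi n j) = hi n i := hlo ▸ Equiv.swap_apply_right _ _
  have h₆ : simple n j (lo n i) = lo n i := by
    apply Equiv.swap_apply_of_ne_of_ne <;> rw [Ne, Fin.ext_iff] <;> simp only [lo, hi] <;> omega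
  have hTi := g_add_correction hu hΦ i
  have hTj := g_add_correction hu hΦ j
  rw [hlo] at hTj
  have hsq (x y : Fin n) : Φ (correction r q x y) * Φ (correction r q x y)
      = algebraMap R _ ((q : R) - ((q⁻¹ : Rˣ) : R)) * Φ (correction r q x y) := by
    rw [← map_mul, ← AlgHom.commutes Φ, ← map_mul]
    congr 1
    funext k
    simp only [Pi.mul_apply, Pi.algebraMap_apply, Algebra.algebraMap_self, RingHom.id_apply,
      correction]
    split_ifs <;> ring
  have hcomm (f f' : (Fin n → Fin r) → R) : Φ f * Φ f' = Φ f' * Φ f := by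
    rw [← map_mul, ← map_mul, mul_comm]
  refine braid_of_add_braid (a := Φ (correction r q (lo n i) (hi n i)))
    (b := Φ (correction r q (hi n i) (hi n j))) (c := Φ (correction r q (lo n i) (hi n j)))
    (a' := Φ (correction r q (hi n i) (lo n i))) (b' := Φ (correction r q (hi n j) (hi n i)))
    (h := algebraMap R _ ((q : R) - ((q⁻¹ : Rˣ) : R)))
    ?_ ?_ ?_
    (g_mul_correction hu hFeval hΦ i h₁ h₂) (g_mul_correction hu hFeval hΦ i h₂ h₃)
    (g_mul_correction hu hFeval hΦ i h₁ h₃) (g_mul_correction hu hFeval hΦ j h₄ h₅)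
    (g_mul_correction hu hFeval hΦ j h₆ h₄) (g_mul_correction hu hFeval hΦ j h₆ h₅)
    (hsq _ _) (hsq _ _) (Algebra.commutes _ _).symm
    (hcomm _ _) (hcomm _ _) (hcomm _ _) ?_ ?_
  · rw [hTi, hTj]
    exact TT_braid i j hij
  · rw [hTi]
    exact TT_mul_self i
  · rw [hTj]
    exact TT_mul_self j
  · simp only [← map_mul]
    congr 1
    funext k
    simp only [Pi.mul_apply, correction]
    split_ifs <;> ring
  · simp only [← AlgHom.commutes Φ, ← map_mul, ← map_add]
    congr 1
    funext k
    simp only [Pi.mul_apply, Pi.add_apply, Pi.algebraMap_apply, Algebra.algebraMap_self,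
      RingHom.id_apply, correction]
    split_ifs <;> first | (exfalso; order) | ring

end ArikiKoike

end MAK

/-- Proposition 3.6: the braid relations for `g_1, …, g_{n-1}`. -/
theorem statement6
    (R : Type*) [CommRing R] [IsDomain R] (n r : ℕ) (hn : 1 ≤ n) (hr : 1 ≤ r)
    (q Δ : Rˣ) (u : Fin r → R) (F : Fin r → R[X])
    (hΔ : (Δ : R) = ∏ i : Fin r, ∏ j ∈ Finset.univ.filter (fun j => j < i), (u i - u j))
    (hFdeg : ∀ c : Fin r, (F c).degree = ((r - 1 : ℕ) : WithBot ℕ))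
    (hFeval : ∀ c c' : Fin r, (F c).eval (u c') = if c' = c then (Δ : R) else 0) :
    (∀ i j : Fin (n - 1), i.1 + 1 < j.1 ∨ j.1 + 1 < i.1 →
        g R n r q Δ u F i * g R n r q Δ u F j = g R n r q Δ u F j * g R n r q Δ u F i) ∧
    (∀ i j : Fin (n - 1), j.1 = i.1 + 1 →
        g R n r q Δ u F i * g R n r q Δ u F j * g R n r q Δ u F i = g R n r q Δ u F j * g R n r q Δ u F i * g R n r q Δ u F j) := by
  have hu (c d : Fin r) (hcd : c ≠ d) : IsUnit (u c - u d) := isUnit_sub_of_vandermonde hΔ hcd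
  obtain ⟨Φ, hΦ⟩ := exists_functionHom hr hu (tt R n r q Δ u F) tt_comm aeval_tt_eq_zero
  exact ⟨g_comm hu hFeval hΦ, g_braid hu hFeval hΦ⟩
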